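/- (Proposition 1, PI-PBC global regulation.) Let K_P = K_Pᵀ ≥ 0 and K_I = K_Iᵀ > 0. For every differentiable solution (x, x_c) : ℝ≥0 → ℝⁿ × ℝᵐ of the converter in closed loop with the PI-PBC, i.e. ẋ(t) = (J₀ + Σᵢ₌₁ᵐ Jᵢuᵢ(t) − R)Qx(t) + (G₀ + Σᵢ₌₁ᵐ Gᵢuᵢ(t))E with ẋ_c(t) = ỹ(t) and u(t) = −K_Pỹ(t) − K_Ix_c(t), where ỹ(t) = G_N(x*)ᵀQ(x(t) − x*), the trajectories x and x_c are bounded on [0,∞) and lim_{t→∞} x(t) = x*. -/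

import Mathlib

open Matrix

lemma aux_quad_deriv {k : ℕ} (A : Matrix (Fin k) (Fin k) ℝ) (e : ℝ → Fin k → ℝ) (d : Fin k → ℝ)
    (t : ℝ) (h : HasDerivAt e d t) :
    HasDerivAt (fun s => e s ⬝ᵥ (A *ᵥ e s)) (d ⬝ᵥ (A *ᵥ e t) + e t ⬝ᵥ (A *ᵥ d)) t := by
  rw [hasDerivAt_pi] at h
  have h2 : HasDerivAt (fun s => ∑ i, e s i * ∑ j, A i j * e s j)
      (∑ i, (d i * (∑ j, A i j * e t j) + e t i * (∑ j, A i j * d j))) t := by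
    refine HasDerivAt.fun_sum fun i _ => ?_
    exact (h i).fun_mul (HasDerivAt.fun_sum fun j _ => (h j).const_mul (A i j))
  simp only [dotProduct, mulVec, ← Finset.sum_add_distrib]
  exact h2

lemma aux_coercive {k : ℕ} (A : Matrix (Fin k) (Fin k) ℝ) (hA : A.PosDef) :
    ∃ c > 0, ∀ v : Fin k → ℝ, c * ‖v‖ ^ 2 ≤ v ⬝ᵥ (A *ᵥ v) := by
  have hpos : ∀ v : Fin k → ℝ, v ≠ 0 → 0 < v ⬝ᵥ (A *ᵥ v) := by
    intro v hv
    simpa using hA.dotProduct_mulVec_pos hv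
  have hc : Continuous fun v : Fin k → ℝ => v ⬝ᵥ (A *ᵥ v) := by fun_prop
  rcases (Metric.sphere (0 : Fin k → ℝ) 1).eq_empty_or_nonempty with he | hne
  · refine ⟨1, one_pos, fun v => ?_⟩
    by_cases hv : v = 0
    · simp [hv]
    · exfalso
      have : (‖v‖⁻¹ • v) ∈ Metric.sphere (0 : Fin k → ℝ) 1 := by
        simp [norm_smul, hv]
      rw [he] at this
      exact this
  · obtain ⟨w, hw, hmin⟩ := (isCompact_sphere (0 : Fin k → ℝ) 1).exists_isMinOn hne hc.continuousOn
    have hw0 : w ≠ 0 := by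
      rintro rfl
      simp at hw
    refine ⟨_, hpos w hw0, fun v => ?_⟩
    by_cases hv : v = 0
    · simp [hv]
    · have hm : (‖v‖⁻¹ • v) ∈ Metric.sphere (0 : Fin k → ℝ) 1 := by
        simp [norm_smul, hv]
      have h1 := hmin hm
      simp only [Set.mem_ofPred_eq, mulVec_smul, smul_dotProduct, dotProduct_smul, smul_eq_mul] at h1
      have hn : 0 < ‖v‖ := norm_pos_iff.2 hv
      calc _ ≤ (‖v‖⁻¹ * (‖v‖⁻¹ * (v ⬝ᵥ (A *ᵥ v)))) * ‖v‖ ^ 2 := by gcongr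
        _ = _ := by field_simp

lemma aux_barbalat (W f W' f' : ℝ → ℝ) (L : ℝ) (hL : 0 < L)
    (hW : ∀ t ≥ 0, HasDerivAt W (W' t) t) (hf : ∀ t ≥ 0, HasDerivAt f (f' t) t)
    (hWf : ∀ t ≥ 0, W' t ≤ - f t) (hf0 : ∀ t, 0 ≤ f t) (hW0 : ∀ t, 0 ≤ W t)
    (hfL : ∀ t ≥ 0, |f' t| ≤ L) : Filter.Tendsto f Filter.atTop (nhds 0) := by
  have anti : AntitoneOn W (Set.Ici 0) := by
    refine antitoneOn_of_hasDerivWithinAt_nonpos (convex_Ici 0) (f' := W')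
      (fun t ht => (hW t ht).continuousAt.continuousWithinAt) ?_ ?_
    · intro t ht
      exact (hW t (interior_subset ht)).hasDerivWithinAt
    · intro t ht
      have ht' := interior_subset ht
      linarith [hWf t ht', hf0 t]
  have key : ∀ t ≥ 0, ∀ δ ≥ 0, δ * f t ≤ W t - W (t + δ) + L * δ ^ 2 / 2 := by
    intro t ht δ hδ
    have flow : ∀ s ≥ t, f t - L * (s - t) ≤ f s := by
      intro s hs
      have mono : MonotoneOn (fun s => f s + L * s) (Set.Ici 0) := by
        refine monotoneOn_of_hasDerivWithinAt_nonneg (convex_Ici 0) (f' := fun s => f' s + L * 1)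
          (fun t ht => ?_) ?_ ?_
        · exact ((hf t ht).continuousAt.add (by fun_prop)).continuousWithinAt
        · intro t ht
          exact ((hf t (interior_subset ht)).fun_add
            ((hasDerivAt_id t).const_mul L)).hasDerivWithinAt
        · intro t ht
          have := abs_le.1 (hfL t (interior_subset ht))
          linarith
      have := mono (show t ∈ Set.Ici 0 from ht) (show s ∈ Set.Ici 0 from le_trans ht hs) hs
      try simp only at this
      linarith
    have hd : ∀ s ≥ t, HasDerivAt (fun s => W s + f t * s - L * (s - t) ^ 2 / 2)
        (W' s + f t - L * (s - t)) s := by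
      intro s hs
      have h1 := ((hasDerivAt_id s).sub_const t).fun_pow 2
      have h2 := (((hW s (le_trans ht hs)).fun_add ((hasDerivAt_id s).const_mul (f t))).fun_sub
        ((h1.const_mul L).div_const 2))
      refine HasDerivAt.congr_deriv h2 ?_
      simp
      ring
    have an : AntitoneOn (fun s => W s + f t * s - L * (s - t) ^ 2 / 2) (Set.Ici t) := by
      refine antitoneOn_of_hasDerivWithinAt_nonpos (convex_Ici t)
        (f' := fun s => W' s + f t - L * (s - t))
        (fun s hs => (hd s hs).continuousAt.continuousWithinAt) ?_ ?_
      · intro s hs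
        exact (hd s (interior_subset hs)).hasDerivWithinAt
      · intro s hs
        have hs' : t ≤ s := interior_subset hs
        linarith [hWf s (le_trans ht hs'), flow s hs']
    have := an (show t ∈ Set.Ici t from le_refl t)
      (show t + δ ∈ Set.Ici t from by simpa using hδ) (by linarith)
    simp only at this
    have e1 : t + δ - t = δ := by ring
    rw [e1] at this
    nlinarith
  -- the infimum of W
  have hbdd : BddBelow (W '' Set.Ici 0) := ⟨0, by rintro _ ⟨t, _, rfl⟩; exact hW0 t⟩
  have hne : (W '' Set.Ici 0).Nonempty := ⟨W 0, 0, by simp, rfl⟩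
  rw [Metric.tendsto_atTop]
  intro ε hε
  set δ := ε / L with hδ
  have hδ0 : 0 < δ := by positivity
  obtain ⟨_, ⟨T, hT, rfl⟩, hTlt⟩ := exists_lt_of_csInf_lt hne
    (show sInf (W '' Set.Ici 0) < sInf (W '' Set.Ici 0) + δ * ε / 4 by
      have : 0 < δ * ε / 4 := by positivity
      linarith)
  refine ⟨T, fun t ht => ?_⟩
  have ht0 : (0 : ℝ) ≤ t := le_trans hT ht
  have h1 := key t ht0 δ hδ0.le
  have h2 : W t ≤ W T := anti hT ht0 ht
  have h3 : sInf (W '' Set.Ici 0) ≤ W (t + δ) :=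
    csInf_le hbdd ⟨t + δ, by simp only [Set.mem_Ici]; linarith, rfl⟩
  rw [Real.dist_eq, sub_zero, abs_of_nonneg (hf0 t)]
  have h4 : L * δ = ε := by rw [hδ]; field_simp
  have h5 : δ * f t < δ * ε := by
    have : L * δ ^ 2 / 2 = δ * ε / 2 := by rw [← h4]; ring
    have : 0 < δ * ε := by positivity
    linarith
  exact lt_of_mul_lt_mul_left h5 hδ0.le

/-- Proposition 1, PI-PBC global regulation. Every differentiable solution
of the converter in closed loop with the PI-PBC is bounded on `[0,∞)` and its state
converges to the admissible equilibrium `x*`. -/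
theorem pi_pbc_global_regulation {n m : ℕ}
    (J₀ : Matrix (Fin n) (Fin n) ℝ) (J : Fin m → Matrix (Fin n) (Fin n) ℝ)
    (R Q G₀ : Matrix (Fin n) (Fin n) ℝ) (G : Fin m → Matrix (Fin n) (Fin n) ℝ)
    (E : Fin n → ℝ) (xs : Fin n → ℝ) (us : Fin m → ℝ)
    (hJ₀ : J₀ᵀ = -J₀) (hJ : ∀ i, (J i)ᵀ = -(J i))
    (hR : R.PosDef) (hQ : Q.PosDef) (hQdiag : Q.IsDiag)
    -- admissible equilibrium
    (heq : 0 = (J₀ + ∑ i, us i • J i - R).mulVec (Q.mulVec xs)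
            + (G₀ + ∑ i, us i • G i).mulVec E)
    -- G_N(x) and the shifted passive output ỹ = G_N(x*)ᵀ Q (x − x*)
    (GN : (Fin n → ℝ) → Matrix (Fin n) (Fin m) ℝ)
    (hGN : ∀ z, GN z = Matrix.of fun k i => ((J i).mulVec (Q.mulVec z) + (G i).mulVec E) k)
    -- PI gains
    (KP KI : Matrix (Fin m) (Fin m) ℝ) (hKP : KP.PosSemidef) (hKI : KI.PosDef)
    -- closed-loop trajectories
    (x : ℝ → Fin n → ℝ) (xc : ℝ → Fin m → ℝ) (u : ℝ → Fin m → ℝ)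
    (ytil : ℝ → Fin m → ℝ)
    (hytil : ∀ t, ytil t = (GN xs)ᵀ.mulVec (Q.mulVec (x t - xs)))
    (hxc : ∀ t ≥ (0:ℝ), HasDerivAt xc (ytil t) t)
    (hu : ∀ t ≥ (0:ℝ), u t = -KP.mulVec (ytil t) - KI.mulVec (xc t))
    (hx : ∀ t ≥ (0:ℝ), HasDerivAt x
      ((J₀ + ∑ i, u t i • J i - R).mulVec (Q.mulVec (x t))
        + (G₀ + ∑ i, u t i • G i).mulVec E) t) :
    (∃ M : ℝ, ∀ t ≥ (0:ℝ), ‖x t‖ ≤ M ∧ ‖xc t‖ ≤ M)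
    ∧ Filter.Tendsto x Filter.atTop (nhds xs) := by
  classical
  have skew : ∀ (A : Matrix (Fin n) (Fin n) ℝ), Aᵀ = -A → ∀ p : Fin n → ℝ, p ⬝ᵥ (A *ᵥ p) = 0 := by
    intro A hA p
    have h1 : p ⬝ᵥ (A *ᵥ p) = (Aᵀ *ᵥ p) ⬝ᵥ p := by
      rw [mulVec_transpose, dotProduct_mulVec]
    rw [hA, neg_mulVec, neg_dotProduct, dotProduct_comm (A *ᵥ p)] at h1
    linarith
  have symm_dot : ∀ {k : ℕ} (A : Matrix (Fin k) (Fin k) ℝ), Aᵀ = A → ∀ p q : Fin k → ℝ,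
      p ⬝ᵥ (A *ᵥ q) = q ⬝ᵥ (A *ᵥ p) := by
    intro k A hA p q
    rw [dotProduct_mulVec, ← mulVec_transpose, hA, dotProduct_comm]
  have hQt : Qᵀ = Q := by simpa using hQ.isHermitian.eq
  have hKIt : KIᵀ = KI := by simpa using hKI.isHermitian.eq
  -- integrator equilibrium
  obtain ⟨zs, hzs⟩ : ∃ zs : Fin m → ℝ, KI *ᵥ zs = -us := by
    refine ⟨KI⁻¹ *ᵥ (-us), ?_⟩
    rw [mulVec_mulVec, mul_nonsing_inv _ ((isUnit_iff_isUnit_det _).1 hKI.isUnit), one_mulVec]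
  -- shifted dynamics
  have hGNv : ∀ v : Fin m → ℝ, GN xs *ᵥ v
      = (∑ i, v i • J i) *ᵥ (Q *ᵥ xs) + (∑ i, v i • G i) *ᵥ E := by
    intro v
    rw [hGN, sum_mulVec, sum_mulVec, ← Finset.sum_add_distrib]
    ext k
    rw [Finset.sum_apply]
    change ∑ i, (J i *ᵥ (Q *ᵥ xs) + G i *ᵥ E) k * v i = _
    refine Finset.sum_congr rfl fun i _ => ?_
    simp only [smul_mulVec, Pi.add_apply, Pi.smul_apply, smul_eq_mul]
    ring
  have hdyn : ∀ w : Fin m → ℝ, ∀ z : Fin n → ℝ,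
      (J₀ + ∑ i, w i • J i - R) *ᵥ (Q *ᵥ z) + (G₀ + ∑ i, w i • G i) *ᵥ E
      = (J₀ + ∑ i, w i • J i - R) *ᵥ (Q *ᵥ (z - xs)) + GN xs *ᵥ (w - us) := by
    intro w z
    rw [hGNv]
    have e1 : ∑ i, (w - us) i • J i = ∑ i, w i • J i - ∑ i, us i • J i := by
      simp [sub_smul]
    have e2 : ∑ i, (w - us) i • G i = ∑ i, w i • G i - ∑ i, us i • G i := by
      simp [sub_smul]
    rw [e1, e2]
    generalize ∑ i, w i • J i = A at *
    generalize ∑ i, w i • G i = B at *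
    generalize ∑ i, us i • J i = A' at *
    generalize ∑ i, us i • G i = B' at *
    simp only [sub_mulVec, add_mulVec, mulVec_sub] at heq ⊢
    linear_combination -heq
  set F : (Fin n → ℝ) → (Fin m → ℝ) → (Fin n → ℝ) := fun z w =>
    (J₀ + ∑ i, w i • J i - R) *ᵥ (Q *ᵥ z) + (G₀ + ∑ i, w i • G i) *ᵥ E with hF
  have he : ∀ t ≥ (0:ℝ), HasDerivAt (fun s => x s - xs) (F (x t) (u t)) t :=
    fun t ht => (hx t ht).sub_const xs
  have hz : ∀ t ≥ (0:ℝ), HasDerivAt (fun s => xc s - zs) (ytil t) t :=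
    fun t ht => (hxc t ht).sub_const zs
  set S : Matrix (Fin n) (Fin n) ℝ := Q * R * Q with hS
  have hSpos : S.PosDef := by
    have h := hR.conjTranspose_mul_mul_same (B := Q)
      (mulVec_injective_of_isUnit hQ.isUnit)
    rwa [hQ.isHermitian.eq] at h
  have hSe : ∀ e : Fin n → ℝ, e ⬝ᵥ (S *ᵥ e) = (Q *ᵥ e) ⬝ᵥ (R *ᵥ (Q *ᵥ e)) := by
    intro e
    rw [hS, ← mulVec_mulVec, ← mulVec_mulVec, dotProduct_mulVec, ← mulVec_transpose, hQt]
  set W : ℝ → ℝ := fun t => ((x t - xs) ⬝ᵥ (Q *ᵥ (x t - xs)) + (xc t - zs) ⬝ᵥ (KI *ᵥ (xc t - zs))) / 2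
    with hWdef
  set W' : ℝ → ℝ := fun t => ((F (x t) (u t) ⬝ᵥ (Q *ᵥ (x t - xs)) + (x t - xs) ⬝ᵥ (Q *ᵥ F (x t) (u t)))
    + (ytil t ⬝ᵥ (KI *ᵥ (xc t - zs)) + (xc t - zs) ⬝ᵥ (KI *ᵥ ytil t))) / 2 with hW'def
  have hW : ∀ t ≥ (0:ℝ), HasDerivAt W (W' t) t := fun t ht =>
    ((aux_quad_deriv Q _ _ t (he t ht)).fun_add (aux_quad_deriv KI _ _ t (hz t ht))).div_const 2
  have hWle : ∀ t ≥ (0:ℝ), W' t ≤ - ((x t - xs) ⬝ᵥ (S *ᵥ (x t - xs))) := by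
    intro t ht
    have h1 : W' t = F (x t) (u t) ⬝ᵥ (Q *ᵥ (x t - xs)) + ytil t ⬝ᵥ (KI *ᵥ (xc t - zs)) := by
      simp only [hW'def]
      rw [symm_dot Q hQt (x t - xs), symm_dot KI hKIt (xc t - zs)]
      ring
    have h2 : F (x t) (u t) = (J₀ + ∑ i, u t i • J i - R) *ᵥ (Q *ᵥ (x t - xs))
        + GN xs *ᵥ (u t - us) := hdyn _ _
    have h3 : u t - us = -(KP *ᵥ ytil t) - KI *ᵥ (xc t - zs) := by
      rw [hu t ht, mulVec_sub, hzs]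
      abel
    have h4 : (GN xs *ᵥ (u t - us)) ⬝ᵥ (Q *ᵥ (x t - xs)) = (u t - us) ⬝ᵥ ytil t := by
      rw [hytil, mulVec_transpose, dotProduct_comm, dotProduct_mulVec, dotProduct_comm]
    have h5 : 0 ≤ ytil t ⬝ᵥ (KP *ᵥ ytil t) := by
      simpa using hKP.dotProduct_mulVec_nonneg (ytil t)
    have hsk : (J₀ + ∑ i, u t i • J i)ᵀ = -(J₀ + ∑ i, u t i • J i) := by
      rw [transpose_add, transpose_sum, hJ₀]
      simp [hJ]
      abel
    rw [h1, h2, add_dotProduct, h4, h3, hSe, sub_mulVec, sub_dotProduct, dotProduct_comm _ (Q *ᵥ _),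
      skew _ hsk, sub_dotProduct, neg_dotProduct, dotProduct_comm _ (ytil t),
      dotProduct_comm (KI *ᵥ _) (ytil t), dotProduct_comm (R *ᵥ _)]
    linarith
  obtain ⟨cS, hcS, hcS'⟩ := aux_coercive S hSpos
  obtain ⟨cQ, hcQ, hcQ'⟩ := aux_coercive Q hQ
  obtain ⟨cK, hcK, hcK'⟩ := aux_coercive KI hKI
  have hf0 : ∀ t, 0 ≤ (x t - xs) ⬝ᵥ (S *ᵥ (x t - xs)) := fun t =>
    le_trans (by positivity) (hcS' _)
  have hW0 : ∀ t, 0 ≤ W t := by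
    intro t
    have h1 := hcQ' (x t - xs)
    have h2 := hcK' (xc t - zs)
    have h3 : 0 ≤ cQ * ‖x t - xs‖ ^ 2 := by positivity
    have h4 : 0 ≤ cK * ‖xc t - zs‖ ^ 2 := by positivity
    simp only [hWdef]
    linarith
  have hWanti : ∀ t ≥ (0:ℝ), W t ≤ W 0 := by
    have anti : AntitoneOn W (Set.Ici 0) := by
      refine antitoneOn_of_hasDerivWithinAt_nonpos (convex_Ici 0) (f' := W')
        (fun t ht => (hW t ht).continuousAt.continuousWithinAt) ?_ ?_
      · intro t ht
        exact (hW t (interior_subset ht)).hasDerivWithinAt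
      · intro t ht
        have ht' := interior_subset ht
        linarith [hWle t ht', hf0 t]
    exact fun t ht => anti (show (0:ℝ) ∈ Set.Ici 0 by simp) ht ht
  have sq_bd : ∀ a b : ℝ, a ^ 2 ≤ b → a ≤ b + 1 := by
    intro a b h
    nlinarith [sq_nonneg (a - 1)]
  have hxb : ∀ t ≥ (0:ℝ), ‖x t - xs‖ ≤ 2 * W 0 / cQ + 1 := by
    intro t ht
    apply sq_bd
    rw [le_div_iff₀ hcQ]
    have h1 := hcQ' (x t - xs)
    have h2 := hcK' (xc t - zs)
    have h4 : 0 ≤ cK * ‖xc t - zs‖ ^ 2 := by positivity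
    have h5 := hWanti t ht
    have h6 : 2 * W t = (x t - xs) ⬝ᵥ (Q *ᵥ (x t - xs)) + (xc t - zs) ⬝ᵥ (KI *ᵥ (xc t - zs)) := by
      simp only [hWdef]; ring
    linarith
  have hzb : ∀ t ≥ (0:ℝ), ‖xc t - zs‖ ≤ 2 * W 0 / cK + 1 := by
    intro t ht
    apply sq_bd
    rw [le_div_iff₀ hcK]
    have h1 := hcQ' (x t - xs)
    have h2 := hcK' (xc t - zs)
    have h4 : 0 ≤ cQ * ‖x t - xs‖ ^ 2 := by positivity
    have h5 := hWanti t ht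
    have h6 : 2 * W t = (x t - xs) ⬝ᵥ (Q *ᵥ (x t - xs)) + (xc t - zs) ⬝ᵥ (KI *ᵥ (xc t - zs)) := by
      simp only [hWdef]; ring
    linarith
  refine ⟨⟨max (2 * W 0 / cQ + 1 + ‖xs‖) (2 * W 0 / cK + 1 + ‖zs‖), fun t ht => ⟨?_, ?_⟩⟩, ?_⟩
  · refine le_trans ?_ (le_max_left _ _)
    have := norm_le_norm_sub_add (x t) xs
    linarith [hxb t ht]
  · refine le_trans ?_ (le_max_right _ _)
    have := norm_le_norm_sub_add (xc t) zs
    linarith [hzb t ht]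
  · -- bounded derivative of the dissipation
    set U : (Fin n → ℝ) × (Fin m → ℝ) → Fin m → ℝ := fun q =>
      -KP *ᵥ ((GN xs)ᵀ *ᵥ (Q *ᵥ (q.1 - xs))) - KI *ᵥ q.2 with hU
    have hUc : Continuous U := by
      simp only [hU]
      fun_prop
    set Φ : (Fin n → ℝ) × (Fin m → ℝ) → ℝ := fun q =>
      F q.1 (U q) ⬝ᵥ (S *ᵥ (q.1 - xs)) + (q.1 - xs) ⬝ᵥ (S *ᵥ F q.1 (U q)) with hΦ
    have hFc : Continuous fun q : (Fin n → ℝ) × (Fin m → ℝ) => F q.1 (U q) := by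
      simp only [hF]
      fun_prop
    have hΦc : Continuous Φ := by
      simp only [hΦ]
      fun_prop
    obtain ⟨L, hL⟩ := ((isCompact_closedBall xs (2 * W 0 / cQ + 1)).prod
      (isCompact_closedBall zs (2 * W 0 / cK + 1))).exists_bound_of_continuousOn hΦc.continuousOn
    have hlim := aux_barbalat W (fun t => (x t - xs) ⬝ᵥ (S *ᵥ (x t - xs))) W'
      (fun t => Φ (x t, xc t)) (max L 1) (by positivity) hW (by
        intro t ht
        have h := aux_quad_deriv S _ _ t (he t ht)
        have hUt : U (x t, xc t) = u t := by
          rw [hu t ht, hytil t]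
          simp [hU, neg_mulVec]
        simp only [hΦ, hUt]
        exact h) hWle hf0 hW0 (by
        intro t ht
        refine le_trans (hL (x t, xc t) ⟨?_, ?_⟩) (le_max_left _ _)
        · simpa [dist_eq_norm] using hxb t ht
        · simpa [dist_eq_norm] using hzb t ht)
    rw [tendsto_iff_norm_sub_tendsto_zero]
    have hsq : Filter.Tendsto (fun t => ‖x t - xs‖ ^ 2) Filter.atTop (nhds 0) := by
      have h2 := hlim.div_const cS
      rw [zero_div] at h2
      refine squeeze_zero (fun t => by positivity) (fun t => ?_) h2
      rw [le_div_iff₀ hcS, mul_comm]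
      exact hcS' _
    have := hsq.sqrt
    simpa [Real.sqrt_sq] using this
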